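/- For objects T and A of a cartesian bicategory, the hom-category Map(B)(T,A) can be equivalently described as the category whose objects are the maps f : T → A, whose hom-sets are Map(B)(T,A)(f,g) = Map(B)(T,T)(1_T, A(f,g)) where A(f,g) = f*∘g, whose composition of α̂ : 1_T → A(f,g) and β̂ : 1_T → A(g,h) is the pasting (f* ε_g h)∘(β̂ ⊡ α̂) : 1_T → A(f,h), and whose identities are 1̂_f = η_f : 1_T → A(f,f); under the bijection α ↦ α̂ (taking mates), the displayed pasting composite of β̂ and α̂ equals the hat of the vertical composite β∘α. -/

import Mathlib

/-!
Common setup: an axiomatization of *cartesian bicategories* in the sense of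
Carboni–Kelly–Walters–Wood ("Cartesian bicategories II"), packaging the data
needed to state the results of Walters–Wood, "Frobenius objects in cartesian
bicategories".

A cartesian bicategory is a bicategory `B` such that the subbicategory of maps
(left adjoint 1-cells) has finite products (`⊗`, `I`, with diagonals `d`,
terminal maps `t` and projections `p`, `r`), each hom-category has finite
(local) products, and the induced tensor `⊗` is functorial.  We record this
structure as data: the tensor (on objects, 1-cells and 2-cells, with its
pseudofunctoriality isomorphisms), the associativity and symmetry
equivalences, unit equivalences, the diagonal/terminal/projection maps with
chosen right adjoints, the canonical comparison 2-cells, and local finite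
products of hom-categories (imposed as instance arguments where needed).
-/

open CategoryTheory CategoryTheory.Bicategory CategoryTheory.Limits

universe w v u

/-- The data of a cartesian bicategory structure on a bicategory `B`
(Carboni–Kelly–Walters–Wood). -/
structure CartesianBicat (B : Type u) [Bicategory.{w, v} B] where
  /-- the tensor product (the product of the bicategory of maps) on objects -/
  ten : B → B → B
  /-- the unit object `I` (the terminal object of the bicategory of maps) -/
  unitObj : B
  /-- the tensor product of 1-cells -/
  tensorHom : ∀ {X₁ Y₁ X₂ Y₂ : B}, (X₁ ⟶ Y₁) → (X₂ ⟶ Y₂) → (ten X₁ X₂ ⟶ ten Y₁ Y₂)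
  /-- the tensor product of 2-cells -/
  tensorCell : ∀ {X₁ Y₁ X₂ Y₂ : B} {f g : X₁ ⟶ Y₁} {h k : X₂ ⟶ Y₂},
      (f ⟶ g) → (h ⟶ k) → (tensorHom f h ⟶ tensorHom g k)
  tensorCell_id : ∀ {X₁ Y₁ X₂ Y₂ : B} (f : X₁ ⟶ Y₁) (h : X₂ ⟶ Y₂),
      tensorCell (𝟙 f) (𝟙 h) = 𝟙 (tensorHom f h)
  tensorCell_comp : ∀ {X₁ Y₁ X₂ Y₂ : B} {f g l : X₁ ⟶ Y₁} {h k m : X₂ ⟶ Y₂}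
      (α : f ⟶ g) (β : g ⟶ l) (γ : h ⟶ k) (δ : k ⟶ m),
      tensorCell (α ≫ β) (γ ≫ δ) = tensorCell α γ ≫ tensorCell β δ
  /-- pseudofunctoriality of the tensor: identities -/
  tensorId : ∀ X Y : B, tensorHom (𝟙 X) (𝟙 Y) ≅ 𝟙 (ten X Y)
  /-- pseudofunctoriality of the tensor: composition -/
  tensorComp : ∀ {X Y Z X' Y' Z' : B} (f : X ⟶ Y) (g : Y ⟶ Z) (f' : X' ⟶ Y') (g' : Y' ⟶ Z'),
      tensorHom (f ≫ g) (f' ≫ g') ≅ tensorHom f f' ≫ tensorHom g g'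
  /-- the associativity equivalence `a : (X ⊗ Y) ⊗ Z ⟶ X ⊗ (Y ⊗ Z)` -/
  a : ∀ X Y Z : B, ten (ten X Y) Z ⟶ ten X (ten Y Z)
  /-- a right adjoint pseudo-inverse `a* : X ⊗ (Y ⊗ Z) ⟶ (X ⊗ Y) ⊗ Z` -/
  aInv : ∀ X Y Z : B, ten X (ten Y Z) ⟶ ten (ten X Y) Z
  aAdj : ∀ X Y Z : B, Bicategory.Adjunction (a X Y Z) (aInv X Y Z)
  aIsoLeft : ∀ X Y Z : B, a X Y Z ≫ aInv X Y Z ≅ 𝟙 (ten (ten X Y) Z)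
  aIsoRight : ∀ X Y Z : B, aInv X Y Z ≫ a X Y Z ≅ 𝟙 (ten X (ten Y Z))
  /-- the symmetry equivalence `s : X ⊗ Y ⟶ Y ⊗ X` -/
  s : ∀ X Y : B, ten X Y ⟶ ten Y X
  sIso : ∀ X Y : B, s X Y ≫ s Y X ≅ 𝟙 (ten X Y)
  /-- the left unit equivalence `I ⊗ X ⟶ X` and its pseudo-inverse -/
  lu : ∀ X : B, ten unitObj X ⟶ X
  luInv : ∀ X : B, X ⟶ ten unitObj X
  luIsoLeft : ∀ X : B, lu X ≫ luInv X ≅ 𝟙 (ten unitObj X)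
  luIsoRight : ∀ X : B, luInv X ≫ lu X ≅ 𝟙 X
  /-- the right unit equivalence `X ⊗ I ⟶ X` and its pseudo-inverse -/
  ru : ∀ X : B, ten X unitObj ⟶ X
  ruInv : ∀ X : B, X ⟶ ten X unitObj
  ruIsoLeft : ∀ X : B, ru X ≫ ruInv X ≅ 𝟙 (ten X unitObj)
  ruIsoRight : ∀ X : B, ruInv X ≫ ru X ≅ 𝟙 X
  /-- pseudonaturality of the unit equivalences -/
  luNatInv : ∀ {X Y : B} (f : X ⟶ Y), f ≫ luInv Y ≅ luInv X ≫ tensorHom (𝟙 unitObj) f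
  luNatHom : ∀ {X Y : B} (f : X ⟶ Y), lu X ≫ f ≅ tensorHom (𝟙 unitObj) f ≫ lu Y
  ruNatInv : ∀ {X Y : B} (f : X ⟶ Y), f ≫ ruInv Y ≅ ruInv X ≫ tensorHom f (𝟙 unitObj)
  ruNatHom : ∀ {X Y : B} (f : X ⟶ Y), ru X ≫ f ≅ tensorHom f (𝟙 unitObj) ≫ ru Y
  /-- pseudonaturality of the associativity equivalences -/
  aNat : ∀ {X X' Y Y' Z Z' : B} (f : X ⟶ X') (g : Y ⟶ Y') (h : Z ⟶ Z'),
      a X Y Z ≫ tensorHom f (tensorHom g h) ≅ tensorHom (tensorHom f g) h ≫ a X' Y' Z'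
  aInvNat : ∀ {X X' Y Y' Z Z' : B} (f : X ⟶ X') (g : Y ⟶ Y') (h : Z ⟶ Z'),
      aInv X Y Z ≫ tensorHom (tensorHom f g) h ≅ tensorHom f (tensorHom g h) ≫ aInv X' Y' Z'
  /-- the diagonal map `d = dₓ : X ⟶ X ⊗ X` with a chosen right adjoint `d*` -/
  d : ∀ X : B, X ⟶ ten X X
  dStar : ∀ X : B, ten X X ⟶ X
  dAdj : ∀ X : B, Bicategory.Adjunction (d X) (dStar X)
  /-- the terminal map `t = tₓ : X ⟶ I` with a chosen right adjoint `t*` -/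
  t : ∀ X : B, X ⟶ unitObj
  tStar : ∀ X : B, unitObj ⟶ X
  tAdj : ∀ X : B, Bicategory.Adjunction (t X) (tStar X)
  /-- `tₓ` is the local terminal object (`⊤`) of `B(X, I)` -/
  tTerminal : ∀ X : B, Limits.IsTerminal (t X)
  /-- the product projections `p : X ⊗ Y ⟶ X` and `r : X ⊗ Y ⟶ Y` of the
  bicategory of maps, with chosen right adjoints -/
  p : ∀ X Y : B, ten X Y ⟶ X
  r : ∀ X Y : B, ten X Y ⟶ Y
  pStar : ∀ X Y : B, X ⟶ ten X Y
  rStar : ∀ X Y : B, Y ⟶ ten X Y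
  pAdj : ∀ X Y : B, Bicategory.Adjunction (p X Y) (pStar X Y)
  rAdj : ∀ X Y : B, Bicategory.Adjunction (r X Y) (rStar X Y)
  dProj₁ : ∀ X : B, d X ≫ p X X ≅ 𝟙 X
  dProj₂ : ∀ X : B, d X ≫ r X X ≅ 𝟙 X
  projNat₁ : ∀ {X Y X' Y' : B} (f : X ⟶ X') (g : Y ⟶ Y'),
      tensorHom f g ≫ p X' Y' ≅ p X Y ≫ f
  projNat₂ : ∀ {X Y X' Y' : B} (f : X ⟶ X') (g : Y ⟶ Y'),
      tensorHom f g ≫ r X' Y' ≅ r X Y ≫ g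
  /-- the tensor product of maps is a map, with the tensor of the adjoints as adjoint -/
  tensorAdj : ∀ {X₁ Y₁ X₂ Y₂ : B} {f₁ : X₁ ⟶ Y₁} {g₁ : Y₁ ⟶ X₁} {f₂ : X₂ ⟶ Y₂} {g₂ : Y₂ ⟶ X₂},
      Bicategory.Adjunction f₁ g₁ → Bicategory.Adjunction f₂ g₂ →
        Bicategory.Adjunction (tensorHom f₁ f₂) (tensorHom g₁ g₂)
  /-- coassociativity of the diagonal: `a ∘ (d ⊗ 1) ∘ d ≅ (1 ⊗ d) ∘ d` -/
  coassoc : ∀ X : B, (d X ≫ tensorHom (d X) (𝟙 X)) ≫ a X X X ≅ d X ≫ tensorHom (𝟙 X) (d X)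
  /-- the canonical ("essentially unique") lax comonoid homomorphism 2-cells of an
  arbitrary 1-cell `R`, coming from the finite products of the Grothendieck
  bicategory `G`:  `d̃_R : d_A ∘ R ⇒ (R ⊗ R) ∘ d_X` -/
  dTilde : ∀ {X A : B} (R : X ⟶ A), R ≫ d A ⟶ d X ≫ tensorHom R R
  /-- `t̃_R : t_A ∘ R ⇒ ⊤ = t_X` -/
  tTilde : ∀ {X A : B} (R : X ⟶ A), R ≫ t A ⟶ t X

namespace CartesianBicat

variable {B : Type u} [Bicategory.{w, v} B] (C : CartesianBicat B)

/-- `d ⊗ 1 : A ⊗ A ⟶ (A ⊗ A) ⊗ A`. -/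
def dL (A : B) : C.ten A A ⟶ C.ten (C.ten A A) A := C.tensorHom (C.d A) (𝟙 A)

/-- `d* ⊗ 1 : (A ⊗ A) ⊗ A ⟶ A ⊗ A`. -/
def dLStar (A : B) : C.ten (C.ten A A) A ⟶ C.ten A A := C.tensorHom (C.dStar A) (𝟙 A)

/-- `d ⊗ 1 ⊣ d* ⊗ 1`. -/
def dLAdj (A : B) : Bicategory.Adjunction (C.dL A) (C.dLStar A) :=
  C.tensorAdj (C.dAdj A) (Bicategory.Adjunction.id A)

/-- `1 ⊗ d : A ⊗ A ⟶ A ⊗ (A ⊗ A)`. -/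
def dR (A : B) : C.ten A A ⟶ C.ten A (C.ten A A) := C.tensorHom (𝟙 A) (C.d A)

/-- `1 ⊗ d* : A ⊗ (A ⊗ A) ⟶ A ⊗ A`. -/
def dRStar (A : B) : C.ten A (C.ten A A) ⟶ C.ten A A := C.tensorHom (𝟙 A) (C.dStar A)

/-- `1 ⊗ d ⊣ 1 ⊗ d*`. -/
def dRAdj (A : B) : Bicategory.Adjunction (C.dR A) (C.dRStar A) :=
  C.tensorAdj (Bicategory.Adjunction.id A) (C.dAdj A)

/-- The canonical 2-cell `δ₀ : d ∘ d* ⇒ (1 ⊗ d*) ∘ a ∘ (d ⊗ 1)`, the mate of the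
coassociativity equality under the adjunctions `d ⊣ d*` and `1 ⊗ d ⊣ 1 ⊗ d*`
(the Beck–Chevalley 2-cell of the first coassociativity square). -/
def δ₀ (A : B) : C.dStar A ≫ C.d A ⟶ C.dL A ≫ C.a A A A ≫ C.dRStar A :=
  (ρ_ (C.dStar A ≫ C.d A)).inv ≫
  ((C.dStar A ≫ C.d A) ◁ (C.dRAdj A).unit) ≫
  (α_ (C.dStar A) (C.d A) (C.dR A ≫ C.dRStar A)).hom ≫
  (C.dStar A ◁ (α_ (C.d A) (C.dR A) (C.dRStar A)).inv) ≫
  (C.dStar A ◁ ((C.coassoc A).inv ▷ C.dRStar A)) ≫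
  (C.dStar A ◁ ((α_ (C.d A) (C.dL A) (C.a A A A)).hom ▷ C.dRStar A)) ≫
  (C.dStar A ◁ (α_ (C.d A) (C.dL A ≫ C.a A A A) (C.dRStar A)).hom) ≫
  (C.dStar A ◁ (C.d A ◁ (α_ (C.dL A) (C.a A A A) (C.dRStar A)).hom)) ≫
  (α_ (C.dStar A) (C.d A) (C.dL A ≫ C.a A A A ≫ C.dRStar A)).inv ≫
  ((C.dAdj A).counit ▷ (C.dL A ≫ C.a A A A ≫ C.dRStar A)) ≫
  (λ_ (C.dL A ≫ C.a A A A ≫ C.dRStar A)).hom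

/-- The canonical 2-cell `δ₁ : d ∘ d* ⇒ (d* ⊗ 1) ∘ a* ∘ (1 ⊗ d)`, the mate of the
coassociativity equality under the adjunctions `d ⊣ d*`, `d ⊗ 1 ⊣ d* ⊗ 1` and
`a ⊣ a*` (the Beck–Chevalley 2-cell of the second coassociativity square). -/
def δ₁ (A : B) : C.dStar A ≫ C.d A ⟶ C.dR A ≫ C.aInv A A A ≫ C.dLStar A :=
  (ρ_ (C.dStar A ≫ C.d A)).inv ≫
  ((C.dStar A ≫ C.d A) ◁ ((C.dLAdj A).comp (C.aAdj A A A)).unit) ≫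
  (α_ (C.dStar A) (C.d A) ((C.dL A ≫ C.a A A A) ≫ C.aInv A A A ≫ C.dLStar A)).hom ≫
  (C.dStar A ◁ (α_ (C.d A) (C.dL A ≫ C.a A A A) (C.aInv A A A ≫ C.dLStar A)).inv) ≫
  (C.dStar A ◁ (((α_ (C.d A) (C.dL A) (C.a A A A)).inv ≫ (C.coassoc A).hom) ▷
      (C.aInv A A A ≫ C.dLStar A))) ≫
  (C.dStar A ◁ (α_ (C.d A) (C.dR A) (C.aInv A A A ≫ C.dLStar A)).hom) ≫
  (α_ (C.dStar A) (C.d A) (C.dR A ≫ C.aInv A A A ≫ C.dLStar A)).inv ≫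
  ((C.dAdj A).counit ▷ (C.dR A ≫ C.aInv A A A ≫ C.dLStar A)) ≫
  (λ_ (C.dR A ≫ C.aInv A A A ≫ C.dLStar A)).hom

/-- An object `A` of a cartesian bicategory is *Frobenius* if both Beck–Chevalley
2-cells `δ₀` and `δ₁` of the coassociativity squares are invertible. -/
def Frobenius (A : B) : Prop := IsIso (C.δ₀ A) ∧ IsIso (C.δ₁ A)

/-- `N_X = d_X ∘ t_X* : I ⟶ X ⊗ X`. -/
def N (X : B) : C.unitObj ⟶ C.ten X X := C.tStar X ≫ C.d X

/-- `E_X = t_X ∘ d_X* : X ⊗ X ⟶ I`. -/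
def E (X : B) : C.ten X X ⟶ C.unitObj := C.dStar X ≫ C.t X

/-- A 1-cell of a bicategory is a *map* if it has a right adjoint. -/
def IsMap {X Y : B} (f : X ⟶ Y) : Prop := ∃ g : Y ⟶ X, Nonempty (Bicategory.Adjunction f g)

/-- The horizontal composite of two 2-cells. -/
def hcomp {X Y Z : B} {f f' : X ⟶ Y} {g g' : Y ⟶ Z} (β : f ⟶ f') (γ : g ⟶ g') :
    f ≫ g ⟶ f' ≫ g' := (β ▷ g) ≫ (f' ◁ γ)

/-- For maps `f, g : T ⟶ A` (with right adjoints `fs`, `gs`), a 2-cell `α : f ⇒ g`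
corresponds to the `1_T`-element `α̂ : 1_T ⇒ A(f,g) = f* ∘ g` by taking mates. -/
def hat {T A : B} {f g : T ⟶ A} {fs : A ⟶ T} (adjf : Bicategory.Adjunction f fs)
    (α : f ⟶ g) : 𝟙 T ⟶ g ≫ fs :=
  adjf.unit ≫ (α ▷ fs)

/-- The inverse of the `hat` correspondence: a `1_T`-element `e : 1_T ⇒ A(g,f) = g* ∘ f`
gives back a 2-cell `g ⇒ f`. -/
def unhat {T A : B} {f g : T ⟶ A} {gs : A ⟶ T} (adjg : Bicategory.Adjunction g gs)
    (e : 𝟙 T ⟶ f ≫ gs) : g ⟶ f :=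
  (λ_ g).inv ≫ (e ▷ g) ≫ (α_ f gs g).hom ≫ (f ◁ adjg.counit) ≫ (ρ_ f).hom

/-- The mate `ξ* : x* ⇒ f*` of a 2-cell `ξ : f ⇒ x` between maps. -/
def mateStar {T A : B} {f x : T ⟶ A} {fs xs : A ⟶ T}
    (adjf : Bicategory.Adjunction f fs) (adjx : Bicategory.Adjunction x xs)
    (ξ : f ⟶ x) : xs ⟶ fs :=
  (ρ_ xs).inv ≫ (xs ◁ adjf.unit) ≫ (xs ◁ (ξ ▷ fs)) ≫ (α_ xs x fs).inv ≫
    (adjx.counit ▷ fs) ≫ (λ_ fs).hom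

end CartesianBicat

open CategoryTheory CategoryTheory.Bicategory

namespace CartesianBicat

variable {B : Type u} [Bicategory.{w, v} B]

/-- The composition law on `1_T`-elements: given `α̂ : 1_T ⟶ A(f,g) = f* ∘ g` and
`β̂ : 1_T ⟶ A(g,h) = g* ∘ h`, the pasting composite `(f* ε_g h) ∘ (β̂ ⊡ α̂) : 1_T ⟶
A(f,h) = f* ∘ h`. -/
def compEl {T A : B} {g h : T ⟶ A} {fs gs : A ⟶ T}
    (adjg : Bicategory.Adjunction g gs)
    (u : 𝟙 T ⟶ g ≫ fs) (v : 𝟙 T ⟶ h ≫ gs) : 𝟙 T ⟶ h ≫ fs :=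
  (λ_ (𝟙 T)).inv ≫ hcomp v u ≫ (α_ h gs (g ≫ fs)).hom ≫
    (h ◁ (α_ gs g fs).inv) ≫ (h ◁ (adjg.counit ▷ fs)) ≫ (h ◁ (λ_ fs).hom)

end CartesianBicat

open CartesianBicat

namespace CartesianBicat

variable {B : Type u} [Bicategory.{w, v} B] {T A : B}

/-- The `hat` correspondence is the mate correspondence `homEquiv₂` for 2-cells out of `𝟙 T`. -/
lemma hat_eq_homEquiv₂ {f g : T ⟶ A} {fs : A ⟶ T} (adjf : Bicategory.Adjunction f fs)
    (α : f ⟶ g) : hat adjf α = adjf.homEquiv₂ ((λ_ f).hom ≫ α) := by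
  simp [hat, Bicategory.Adjunction.homEquiv₂_apply]

lemma hat_bijective {f g : T ⟶ A} {fs : A ⟶ T} (adjf : Bicategory.Adjunction f fs) :
    Function.Bijective (fun α : f ⟶ g => hat adjf α) := by
  simp only [hat_eq_homEquiv₂]
  exact ((λ_ f).symm.homFromEquiv.trans adjf.homEquiv₂).bijective

lemma hat_id {f : T ⟶ A} {fs : A ⟶ T} (adjf : Bicategory.Adjunction f fs) :
    hat adjf (𝟙 f) = adjf.unit := by
  simp [hat]

lemma hat_comp {f g h : T ⟶ A} {fs : A ⟶ T} (adjf : Bicategory.Adjunction f fs)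
    (α : f ⟶ g) (β : g ⟶ h) : hat adjf (α ≫ β) = hat adjf α ≫ β ▷ fs := by
  simp [hat]

/-- Composing a `1_T`-element with the hat of `β` is whiskered composition with `β`. -/
lemma compEl_hat {g h : T ⟶ A} {fs gs : A ⟶ T} (adjg : Bicategory.Adjunction g gs)
    (u : 𝟙 T ⟶ g ≫ fs) (β : g ⟶ h) : compEl adjg u (hat adjg β) = u ≫ β ▷ fs := by
  calc
    _ = 𝟙 _ ⊗≫ (adjg.unit ▷ 𝟙 T ≫ (g ≫ gs) ◁ u) ⊗≫
        (β ▷ (gs ≫ g) ≫ h ◁ adjg.counit) ▷ fs ⊗≫ 𝟙 _ := by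
      simp only [compEl, hat, hcomp, comp_whiskerRight, Category.assoc]
      rw [← whisker_exchange_assoc]
      bicategory
    _ = 𝟙 _ ⊗≫ 𝟙 T ◁ u ⊗≫ leftZigzag adjg.unit adjg.counit ▷ fs ⊗≫ β ▷ fs ⊗≫ 𝟙 _ := by
      rw [← whisker_exchange, ← whisker_exchange]
      bicategory
    _ = u ≫ β ▷ fs := by
      rw [adjg.left_triangle]
      bicategory

end CartesianBicat

/-- **Lemma 3.15 (Walters–Wood).** For objects `T` and `A` of a cartesian bicategory,
the hom-category `Map B (T, A)` can be equivalently described as the category whose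
objects are the maps `f : T ⟶ A`, whose hom-sets are the sets of `1_T`-elements
`1_T ⟶ A(f,g) = f* ∘ g`, whose composition of `α̂ : 1_T ⟶ A(f,g)` and
`β̂ : 1_T ⟶ A(g,h)` is the pasting composite `(f* ε_g h) ∘ (β̂ ⊡ α̂) : 1_T ⟶ A(f,h)`,
and whose identities are `1̂_f = η_f : 1_T ⟶ A(f,f)`:  the assignment `α ↦ α̂`
(taking mates) is a bijection, sends identities to units, and sends vertical
composites to the displayed pasting composites. -/
theorem map_homCategory_description {B : Type u} [Bicategory.{w, v} B]
    (C : CartesianBicat B) (T A : B) (f g h : T ⟶ A) (fs gs hs : A ⟶ T)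
    (adjf : Bicategory.Adjunction f fs) (adjg : Bicategory.Adjunction g gs)
    (adjh : Bicategory.Adjunction h hs) :
    Function.Bijective (fun α : f ⟶ g => hat adjf α) ∧
    hat adjf (𝟙 f) = adjf.unit ∧
    (∀ (α : f ⟶ g) (β : g ⟶ h),
      hat adjf (α ≫ β) = compEl adjg (hat adjf α) (hat adjg β)) := by
  refine ⟨hat_bijective adjf, hat_id adjf, fun α β => ?_⟩
  rw [hat_comp, compEl_hat]
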